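/- arXiv:quant-ph/0503083 — 4 statements merged into one kernel-verified Lean document; each statement's English description precedes it below -/
import Mathlib

section
/- Let (Σ, L, κ) be a state property system satisfying the axiom OrthoCom. If p, q ∈ Σ have different classical states, ω(p) ≠ ω(q), then there exists a classical property a with p ∈ κ a and q ∈ κ (aᗮ); in particular p ⊥ q, and ω(p) ≤ a while ω(q) ≤ aᗮ. -/
/-- A state property system `(σ, L, κ)` equipped with an orthocomplementation
satisfying the axiom **OrthoCom**. -/
structure OrthoSPS (σ : Type*) (L : Type*) [CompleteLattice L] where
  /-- the Cartan map -/
  κ : L → Set σ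
  κ_bot : κ ⊥ = ∅
  κ_top : κ ⊤ = Set.univ
  κ_sInf : ∀ s : Set L, κ (sInf s) = ⋂ a ∈ s, κ a
  le_iff : ∀ a b : L, a ≤ b ↔ κ a ⊆ κ b
  /-- the orthocomplementation -/
  perp : L → L
  perp_perp : ∀ a : L, perp (perp a) = a
  perp_anti : ∀ a b : L, a ≤ b → perp b ≤ perp a
  inf_perp : ∀ a : L, a ⊓ perp a = ⊥
  sup_perp : ∀ a : L, a ⊔ perp a = ⊤
  /-- axiom OrthoCom: any state orthogonal to every state in `κ a` lies in `κ (perp a)` -/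
  orthoCom : ∀ (a : L) (q : σ),
    (∀ p ∈ κ a, ∃ b : L, q ∈ κ b ∧ p ∈ κ (perp b)) → q ∈ κ (perp a)

namespace OrthoSPS

variable {σ : Type*} {L : Type*} [CompleteLattice L]

/-- orthogonality of two states: `p ⊥ q` -/
def PerpState (S : OrthoSPS σ L) (p q : σ) : Prop :=
  ∃ a : L, p ∈ S.κ a ∧ q ∈ S.κ (S.perp a)

/-- a property `a` is classical if every state is in `κ a` or in `κ (perp a)` -/
def IsClassical (S : OrthoSPS σ L) (a : L) : Prop :=
  ∀ p : σ, p ∈ S.κ a ∨ p ∈ S.κ (S.perp a)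

/-- the classical state `ω p` of a state `p`: the infimum of all classical properties
actual in `p` -/
def classicalState (S : OrthoSPS σ L) (p : σ) : L :=
  sInf {a : L | S.IsClassical a ∧ p ∈ S.κ a}

/-- `Ω`, the set of all classical states -/
def Omega (S : OrthoSPS σ L) : Set L :=
  Set.range S.classicalState

/-- the classical Cartan map `κ_c` -/
def κc (S : OrthoSPS σ L) (a : L) : Set L :=
  S.classicalState '' S.κ a

end OrthoSPS

namespace OrthoSPS

variable {σ : Type*} {L : Type*} [CompleteLattice L]

theorem IsClassical.perp {S : OrthoSPS σ L} {a : L} (ha : S.IsClassical a) :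
    S.IsClassical (S.perp a) := fun p => by
  rw [S.perp_perp]
  exact (ha p).symm

theorem classicalState_le {S : OrthoSPS σ L} {a : L} {p : σ} (ha : S.IsClassical a)
    (hp : p ∈ S.κ a) : S.classicalState p ≤ a :=
  sInf_le ⟨ha, hp⟩

/-- If no classical property separates `p` from `q`, their classical states agree. -/
theorem classicalState_eq_of_forall_notMem {S : OrthoSPS σ L} {p q : σ}
    (h : ∀ a, S.IsClassical a → p ∈ S.κ a → q ∉ S.κ (S.perp a)) :
    S.classicalState p = S.classicalState q := by
  refine congrArg sInf (Set.ext fun a => and_congr_right fun ha => ⟨fun hp => ?_, fun hq => ?_⟩)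
  · exact (ha q).resolve_right (h a ha hp)
  · refine (ha p).resolve_right fun hp => h _ ha.perp hp ?_
    rwa [S.perp_perp]

end OrthoSPS

/-- states with different classical states are separated by a classical
property, hence orthogonal. -/
theorem exists_classical_separating {σ L : Type*} [CompleteLattice L] (S : OrthoSPS σ L)
    (p q : σ) (h : S.classicalState p ≠ S.classicalState q) :
    (∃ a : L, S.IsClassical a ∧ p ∈ S.κ a ∧ q ∈ S.κ (S.perp a) ∧
      S.classicalState p ≤ a ∧ S.classicalState q ≤ S.perp a) ∧
    S.PerpState p q := by
  obtain ⟨a, ha, hp, hq⟩ :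
      ∃ a, S.IsClassical a ∧ p ∈ S.κ a ∧ q ∈ S.κ (S.perp a) := by
    by_contra! hne
    exact h (OrthoSPS.classicalState_eq_of_forall_notMem hne)
  exact ⟨⟨a, ha, hp, hq, OrthoSPS.classicalState_le ha hp,
    OrthoSPS.classicalState_le ha.perp hq⟩, a, hp, hq⟩
end

section
/- Let (Σ, L, κ) be a state property system satisfying the axiom OrthoCom. For every classical property a, κ_c(aᗮ) is the set-theoretic complement of κ_c(a) in Ω: κ_c(aᗮ) = Ω \ κ_c(a). -/
namespace OrthoSPS

/-- every state makes its own classical state actual -/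
theorem mem_κ_classicalState {σ L : Type*} [CompleteLattice L] (S : OrthoSPS σ L) (p : σ) :
    p ∈ S.κ (S.classicalState p) := by
  rw [classicalState, S.κ_sInf]
  exact Set.mem_iInter₂.2 fun _ hb => hb.2

/-- a classical property is actual in a state iff it lies above its classical state -/
theorem IsClassical.classicalState_le_iff {σ L : Type*} [CompleteLattice L] {S : OrthoSPS σ L}
    {a : L} (ha : S.IsClassical a) {p : σ} : S.classicalState p ≤ a ↔ p ∈ S.κ a :=
  ⟨fun h => (S.le_iff _ _).1 h (S.mem_κ_classicalState p), fun h => sInf_le ⟨ha, h⟩⟩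

/-- no state makes both a property and its orthocomplement actual -/
theorem disjoint_κ_perp {σ L : Type*} [CompleteLattice L] (S : OrthoSPS σ L) (a : L) :
    Disjoint (S.κ a) (S.κ (S.perp a)) := by
  have h : S.κ a ∩ S.κ (S.perp a) = ∅ := by
    rw [← S.κ_bot, ← S.inf_perp a, ← sInf_pair, S.κ_sInf, Set.biInter_pair]
  exact Set.disjoint_iff_inter_eq_empty.2 h

end OrthoSPS

/-- for a classical property `a`, `κ_c (perp a)` is the set-theoretic
complement of `κ_c a` in `Ω`. -/
theorem κc_perp_eq_compl {σ L : Type*} [CompleteLattice L] (S : OrthoSPS σ L)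
    (a : L) (ha : S.IsClassical a) :
    S.κc (S.perp a) = S.Omega \ S.κc a := by
  ext w
  constructor
  · rintro ⟨p, hp, rfl⟩
    refine ⟨⟨p, rfl⟩, ?_⟩
    rintro ⟨q, hq, hqp⟩
    have hpa : p ∈ S.κ a := ha.classicalState_le_iff.1 (hqp ▸ ha.classicalState_le_iff.2 hq)
    exact Set.disjoint_left.1 (S.disjoint_κ_perp a) hpa hp
  · rintro ⟨⟨p, rfl⟩, hp⟩
    exact ⟨p, (ha p).resolve_left fun h => hp ⟨p, h, rfl⟩, rfl⟩
end

section
/- Let (Σ, L, κ) be a state property system satisfying the axiom OrthoCom. If a is a classical property and x, y ∈ L satisfy x ≤ a and y ≤ aᗮ, then (x ⊔ y)ᗮ = (xᗮ ⊓ a) ⊔ (yᗮ ⊓ aᗮ). -/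
namespace OrthoSPS

variable {σ : Type*} {L : Type*} [CompleteLattice L]

theorem κ_mono (S : OrthoSPS σ L) {a b : L} (h : a ≤ b) : S.κ a ⊆ S.κ b :=
  (S.le_iff a b).1 h

theorem κ_inf (S : OrthoSPS σ L) (a b : L) : S.κ (a ⊓ b) = S.κ a ∩ S.κ b := by
  rw [← sInf_pair, S.κ_sInf, Set.biInter_pair]

theorem le_perp_comm (S : OrthoSPS σ L) {a b : L} : a ≤ S.perp b ↔ b ≤ S.perp a :=
  ⟨fun h => by simpa only [S.perp_perp] using S.perp_anti _ _ h,
    fun h => by simpa only [S.perp_perp] using S.perp_anti _ _ h⟩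

theorem perp_sup (S : OrthoSPS σ L) (a b : L) : S.perp (a ⊔ b) = S.perp a ⊓ S.perp b :=
  eq_of_forall_le_iff fun c => by
    rw [S.le_perp_comm, sup_le_iff, le_inf_iff, S.le_perp_comm (a := c),
      S.le_perp_comm (a := c)]

end OrthoSPS

/-- if `a` is classical and `x ≤ a`, `y ≤ perp a`, then
`perp (x ⊔ y) = (perp x ⊓ a) ⊔ (perp y ⊓ perp a)`. -/
theorem perp_sup_eq {σ L : Type*} [CompleteLattice L] (S : OrthoSPS σ L)
    (a x y : L) (ha : S.IsClassical a) (hx : x ≤ a) (hy : y ≤ S.perp a) :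
    S.perp (x ⊔ y) = (S.perp x ⊓ a) ⊔ (S.perp y ⊓ S.perp a) := by
  rw [S.perp_sup]
  apply le_antisymm
  · rw [S.le_iff]
    intro p hp
    rw [S.κ_inf] at hp
    rcases ha p with h | h
    · exact S.κ_mono le_sup_left (by rw [S.κ_inf]; exact ⟨hp.1, h⟩)
    · exact S.κ_mono le_sup_right (by rw [S.κ_inf]; exact ⟨hp.2, h⟩)
  · exact sup_le (inf_le_inf_left _ (S.le_perp_comm.1 hy))
      (le_inf (inf_le_right.trans (S.perp_anti _ _ hx)) inf_le_left)
end

section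
/- Let (Σ, L, κ) be a state property system satisfying the axiom OrthoCom. For every classical property a and every x ∈ L, one has a = (a ⊓ x) ⊔ (a ⊓ xᗮ). -/
namespace OrthoSPS

variable {σ : Type*} {L : Type*} [CompleteLattice L]

theorem mem_κ_inf (S : OrthoSPS σ L) {a b : L} {p : σ} :
    p ∈ S.κ (a ⊓ b) ↔ p ∈ S.κ a ∧ p ∈ S.κ b := by
  rw [← sInf_pair, S.κ_sInf]
  simp

theorem notMem_κ_perp (S : OrthoSPS σ L) {a : L} {p : σ} (h : p ∈ S.κ a) :
    p ∉ S.κ (S.perp a) := by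
  intro h'
  have hp := S.mem_κ_inf.2 ⟨h, h'⟩
  rw [S.inf_perp, S.κ_bot] at hp
  exact hp

/-- A state in a classical property `a` that is orthogonal to `a ⊓ x` is orthogonal to `x`. -/
theorem IsClassical.mem_κ_perp_of_mem_κ_perp_inf {S : OrthoSPS σ L} {a x : L} {q : σ}
    (ha : S.IsClassical a) (hq : q ∈ S.κ a) (hqx : q ∈ S.κ (S.perp (a ⊓ x))) :
    q ∈ S.κ (S.perp x) := by
  refine S.orthoCom x q fun p hp => ?_
  rcases ha p with hpa | hpa
  · exact ⟨S.perp (a ⊓ x), hqx, by rw [S.perp_perp]; exact S.mem_κ_inf.2 ⟨hpa, hp⟩⟩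
  · exact ⟨a, hq, hpa⟩

end OrthoSPS

/-- for a classical property `a` and any `x`,
`a = (a ⊓ x) ⊔ (a ⊓ perp x)`. -/
theorem classical_eq_inf_sup {σ L : Type*} [CompleteLattice L] (S : OrthoSPS σ L)
    (a x : L) (ha : S.IsClassical a) :
    a = (a ⊓ x) ⊔ (a ⊓ S.perp x) := by
  refine le_antisymm ?_ (sup_le inf_le_left inf_le_left)
  rw [← S.perp_perp a, ← S.perp_perp (_ ⊔ _)]
  apply S.perp_anti
  rw [S.perp_perp, S.le_iff]
  intro q hq
  refine (ha q).resolve_left fun hqa => ?_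
  have orthogonal_of_le : ∀ y, a ⊓ y ≤ (a ⊓ x) ⊔ (a ⊓ S.perp x) → q ∈ S.κ (S.perp y) :=
    fun y hy => ha.mem_κ_perp_of_mem_κ_perp_inf hqa ((S.le_iff _ _).1 (S.perp_anti _ _ hy) hq)
  exact S.notMem_κ_perp (orthogonal_of_le x le_sup_left) (orthogonal_of_le (S.perp x) le_sup_right)
end
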